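/- Let 2 ≤ q̃ ≤ ∞ and 2 < q < ∞, and fix a nonzero window φ ∈ C_c^∞(ℝ). Then there exists a constant C > 0 such that for all measurable g, h : ℝ → ℂ with A := ‖ k ↦ ‖g·φ(·−k)‖_{L^{q̃/2}(ℝ)} ‖_{L^{q/2,∞}(ℝ, dk)} < ∞ and B := ‖ k ↦ ‖h·φ(·−k)‖_{L^{q̃′}(ℝ)} ‖_{L^{q′}(ℝ, dk)} < ∞ (where q̃′, q′ are the conjugate exponents of q̃, q), the convolution g∗h is defined a.e. and ‖ k ↦ ‖(g∗h)·φ(·−k)‖_{L^{q̃}(ℝ)} ‖_{L^{q}(ℝ, dk)} ≤ C·A·B. -/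

import Mathlib

open MeasureTheory Real Complex
open scoped ENNReal NNReal

noncomputable section

/-- The `L^p` norm (with `p ∈ [1,∞]`) of an `ℝ≥0∞`-valued function. -/
def LpE {α : Type*} [MeasurableSpace α] (μ : Measure α) (p : ℝ≥0∞)
    (f : α → ℝ≥0∞) : ℝ≥0∞ :=
  if p = ∞ then essSup f μ else (∫⁻ a, f a ^ p.toReal ∂μ) ^ (1 / p.toReal)

/-- The weak `L^p` quasi-norm `sup_{λ>0} λ |{k : g k > λ}|^{1/p}` on `ℝ`. -/
def wkLp (p : ℝ) (g : ℝ → ℝ≥0∞) : ℝ≥0∞ :=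
  ⨆ lam : ℝ≥0, (lam : ℝ≥0∞) * (volume {k : ℝ | (lam : ℝ≥0∞) < g k}) ^ (1 / p)

/-- Duality: a bound on pairings against all `f ∈ L^p` bounds the `L^q` norm. -/
lemma dual_bound {p q : ℝ} (hpq : p.HolderConjugate q) {U : ℝ → ℝ≥0∞} (hU : Measurable U)
    {K : ℝ≥0∞}
    (h : ∀ f : ℝ → ℝ≥0∞, Measurable f → ∫⁻ x, f x ^ p < ∞ →
      ∫⁻ x, f x * U x ≤ K * (∫⁻ x, f x ^ p) ^ (1 / p)) :
    (∫⁻ x, U x ^ q) ^ (1 / q) ≤ K := by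
  have hq0 : 0 < q := hpq.symm.pos
  have hp0 : 0 < p := hpq.pos
  have hq1 : 1 < q := hpq.symm.lt
  set V : ℕ → ℝ → ℝ≥0∞ := fun n => (Set.Icc (-(n:ℝ)) n).indicator (fun x => min (U x) n) with hV
  have hVm : ∀ n, Measurable (V n) := fun n =>
    (hU.min measurable_const).indicator measurableSet_Icc
  have hVU : ∀ n x, V n x ≤ U x := by
    intro n x
    simp only [hV, Set.indicator_apply]
    split_ifs
    · exact min_le_left _ _
    · exact zero_le
  have key : ∀ n, ∫⁻ x, V n x ^ q ≤ K ^ q := by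
    intro n
    have hfin : ∫⁻ x, V n x ^ q < ∞ := by
      have : ∀ x, V n x ^ q ≤ (Set.Icc (-(n:ℝ)) n).indicator (fun _ => (n : ℝ≥0∞) ^ q) x := by
        intro x
        simp only [hV, Set.indicator_apply]
        split_ifs
        · gcongr
          exact min_le_right _ _
        · simp [hq0]
      refine (lintegral_mono this).trans_lt ?_
      rw [lintegral_indicator measurableSet_Icc]
      simp only [lintegral_const, Measure.restrict_apply MeasurableSet.univ, Set.univ_inter,
        Real.volume_Icc]
      exact ENNReal.mul_lt_top (ENNReal.rpow_lt_top_of_nonneg hq0.le (by simp)) (by simp)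
    have e1 : ∀ x, (V n x ^ (q - 1)) ^ p = V n x ^ q := by
      intro x
      rw [← ENNReal.rpow_mul]
      congr 1
      have := hpq.symm.sub_one_mul_conj
      linarith
    have h1 := h (fun x => V n x ^ (q - 1)) ((hVm n).pow_const _) (by simpa only [e1] using hfin)
    simp only [e1] at h1
    have h2 : ∫⁻ x, V n x ^ q ≤ ∫⁻ x, V n x ^ (q - 1) * U x := by
      refine lintegral_mono fun x => ?_
      calc V n x ^ q = V n x ^ (q - 1) * V n x := by
            conv_lhs => rw [show q = (q - 1) + 1 by ring,
              ENNReal.rpow_add_of_nonneg _ _ (by linarith) (by norm_num), ENNReal.rpow_one]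
        _ ≤ _ := by gcongr; exact hVU n x
    set J := ∫⁻ x, V n x ^ q with hJ
    have h3 : J ≤ K * J ^ (1 / p) := h2.trans h1
    by_cases hJ0 : J = 0
    · rw [hJ0]; exact zero_le
    have h4 : J ^ (1 / q) ≤ K := by
      have e : J = J ^ (1 / q) * J ^ (1 / p) := by
        rw [← ENNReal.rpow_add _ _ hJ0 hfin.ne]
        have := hpq.inv_add_inv_eq_one
        rw [show 1 / q + 1 / p = 1 by simp only [one_div]; linarith, ENNReal.rpow_one]
      rw [e] at h3
      rw [← e] at h3
      have hne : J ^ (1 / p) ≠ 0 := by simp [hJ0, hfin.ne]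
      have hnt : J ^ (1 / p) ≠ ∞ := ENNReal.rpow_ne_top_of_nonneg (by positivity) hfin.ne
      have h5 : J ^ (1 / q) * J ^ (1 / p) ≤ K * J ^ (1 / p) := by rw [← e]; exact h3
      exact (ENNReal.mul_le_mul_iff_left hne hnt).1 h5
    calc J = (J ^ (1 / q)) ^ q := by
          rw [← ENNReal.rpow_mul, one_div_mul_cancel hq0.ne', ENNReal.rpow_one]
      _ ≤ K ^ q := by gcongr
  have hmono : Monotone fun n x => V n x ^ q := by
    intro m n hmn x
    have hmn' : (m : ℝ) ≤ n := by exact_mod_cast hmn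
    refine ENNReal.rpow_le_rpow ?_ hq0.le
    simp only [hV]
    refine (Set.indicator_le_indicator_of_subset (Set.Icc_subset_Icc (neg_le_neg hmn') hmn')
      (fun _ => zero_le) x).trans ?_
    refine Set.indicator_le_indicator ?_
    gcongr
  have hsup : ∀ x, U x ^ q ≤ ⨆ n, V n x ^ q := by
    intro x
    obtain ⟨N, hN⟩ := exists_nat_ge |x|
    have hmem : ∀ n, N ≤ n → V n x = min (U x) n := by
      intro n hn
      have hn' : (N : ℝ) ≤ n := by exact_mod_cast hn
      have := abs_le.1 hN
      simp only [hV]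
      rw [Set.indicator_of_mem]
      exact ⟨by linarith, by linarith⟩
    by_cases hx : U x = ∞
    · rw [hx, ENNReal.top_rpow_of_pos hq0, top_le_iff, iSup_eq_top]
      intro b hb
      have : b ^ (1 / q) < ∞ := ENNReal.rpow_lt_top_of_nonneg (by positivity) hb.ne
      obtain ⟨n, hn⟩ := ENNReal.exists_nat_gt this.ne
      refine ⟨max n N, ?_⟩
      rw [hmem _ (le_max_right _ _), hx]
      simp only [le_top, inf_of_le_right]
      rw [← ENNReal.rpow_inv_lt_iff hq0, ← one_div]
      exact hn.trans_le (by gcongr; exact le_max_left _ _)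
    · obtain ⟨n, hn⟩ := ENNReal.exists_nat_gt hx
      refine le_iSup_of_le (max n N) ?_
      rw [hmem _ (le_max_right _ _), min_eq_left]
      exact hn.le.trans (by gcongr; exact le_max_left _ _)
  have : ∫⁻ x, U x ^ q ≤ K ^ q := by
    calc ∫⁻ x, U x ^ q ≤ ∫⁻ x, ⨆ n, V n x ^ q := lintegral_mono hsup
      _ = ⨆ n, ∫⁻ x, V n x ^ q := lintegral_iSup (fun n => (hVm n).pow_const _) hmono
      _ ≤ K ^ q := iSup_le key
  calc (∫⁻ x, U x ^ q) ^ (1 / q) ≤ (K ^ q) ^ (1 / q) := by gcongr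
    _ = K := by rw [← ENNReal.rpow_mul, mul_one_div_cancel hq0.ne', ENNReal.rpow_one]

/-- Minkowski's integral inequality, finite exponent. -/
lemma minkowski_fin {β : Type*} [MeasurableSpace β] (ν : Measure β) [SFinite ν]
    {p q : ℝ} (hpq : p.HolderConjugate q) {u : ℝ → β → ℝ≥0∞} (hu : Measurable (Function.uncurry u)) :
    (∫⁻ t, (∫⁻ y, u t y ∂ν) ^ q) ^ (1 / q) ≤ ∫⁻ y, (∫⁻ t, u t y ^ q) ^ (1 / q) ∂ν := by
  refine dual_bound hpq hu.lintegral_prod_right ?_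
  intro f hf hfin
  have h1 : ∀ t, f t * ∫⁻ y, u t y ∂ν = ∫⁻ y, f t * u t y ∂ν := fun t =>
    (lintegral_const_mul _ (hu.comp measurable_prodMk_left)).symm
  simp only [h1]
  rw [lintegral_lintegral_swap]
  · rw [mul_comm, ← lintegral_const_mul]
    · refine lintegral_mono fun y => ?_
      exact ENNReal.lintegral_mul_le_Lp_mul_Lq volume hpq hf.aemeasurable
        (hu.comp measurable_prodMk_right).aemeasurable
    · refine Measurable.pow_const ?_ _
      exact (hu.pow_const q).lintegral_prod_left'
  · exact ((hf.comp measurable_fst).mul hu).aemeasurable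

lemma measurable_LpE {β : Type*} [MeasurableSpace β] (P : ℝ≥0∞)
    {u : ℝ → β → ℝ≥0∞} (hu : Measurable (Function.uncurry u)) :
    Measurable fun y => LpE volume P (fun t => u t y) := by
  unfold LpE
  split_ifs with hP
  · refine measurable_of_Ioi fun a => ?_
    have : (fun y => essSup (fun t => u t y) volume) ⁻¹' Set.Ioi a =
        {y | volume ((fun t => (t, y)) ⁻¹' (Function.uncurry u ⁻¹' Set.Ioi a)) = 0}ᶜ := by
      ext y
      simp only [Set.mem_preimage, Set.mem_Ioi, Set.mem_compl_iff, Set.mem_ofPred_eq]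
      rw [← not_le, not_iff_not]
      constructor
      · intro h
        have := ENNReal.ae_le_essSup (μ := volume) (fun t => u t y)
        have h2 : ∀ᵐ t, u t y ≤ a := this.mono fun t ht => ht.trans h
        rw [ae_iff] at h2
        simpa [Set.preimage, Function.uncurry] using h2
      · intro h
        refine essSup_le_of_ae_le _ ?_
        change ∀ᵐ t, u t y ≤ a
        rw [ae_iff]
        simpa [Set.preimage, Function.uncurry] using h
    rw [this]
    exact (measurable_measure_prodMk_right (hu measurableSet_Ioi)
      (measurableSet_singleton 0)).compl
  · exact (hu.pow_const _).lintegral_prod_left'.pow_const _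

/-- Minkowski's integral inequality for `LpE`. -/
lemma minkowski {β : Type*} [MeasurableSpace β] (ν : Measure β) [SFinite ν]
    {P : ℝ≥0∞} (hP : 1 < P) {u : ℝ → β → ℝ≥0∞} (hu : Measurable (Function.uncurry u)) :
    LpE volume P (fun t => ∫⁻ y, u t y ∂ν) ≤ ∫⁻ y, LpE volume P (fun t => u t y) ∂ν := by
  have hm := measurable_LpE P hu
  by_cases hPt : P = ∞
  · subst hPt
    simp only [LpE, if_true] at hm ⊢
    refine essSup_le_of_ae_le _ ?_
    have h1 : ∀ᵐ y ∂ν, ∀ᵐ t, u t y ≤ essSup (fun t => u t y) volume :=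
      Filter.Eventually.of_forall fun y => ENNReal.ae_le_essSup _
    rw [Measure.ae_ae_comm] at h1
    · exact h1.mono fun t ht => lintegral_mono_ae ht
    · exact measurableSet_le (hu.comp measurable_swap) (hm.comp measurable_fst)
  · simp only [LpE, if_neg hPt]
    have : 1 < P.toReal := by
      rw [← ENNReal.toReal_one]
      exact (ENNReal.toReal_lt_toReal (by simp) hPt).2 hP
    exact minkowski_fin ν (Real.HolderConjugate.conjExponent this).symm hu

/-- Young's inequality in the special case needed, finite exponent. -/
lemma young_fin {p q : ℝ} (hpq : p.HolderConjugate q) (hq : 2 ≤ q) {g h : ℝ → ℝ≥0∞}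
    (hg : Measurable g) (hh : Measurable h) :
    (∫⁻ t, (∫⁻ s, g (t - s) * h s) ^ q) ^ (1 / q) ≤
      (∫⁻ t, g t ^ (q / 2)) ^ (1 / (q / 2)) * (∫⁻ s, h s ^ p) ^ (1 / p) := by
  have hq0 : 0 < q := hpq.symm.pos
  have hp0 : 0 < p := hpq.pos
  have hpqe : p * (1 - 1 / q) = 1 := by
    have := hpq.inv_add_inv_eq_one
    have h2 : 1 - 1 / q = p⁻¹ := by rw [one_div]; linarith
    rw [h2, mul_inv_cancel₀ hp0.ne']
  set X := ∫⁻ t, g t ^ (q / 2) with hX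
  set Y := ∫⁻ s, h s ^ p with hY
  have hG : Measurable fun x : ℝ × ℝ => g (x.1 - x.2) ^ (q / 2) * h x.2 ^ p :=
    ((hg.comp (measurable_fst.sub measurable_snd)).pow_const _).mul
      ((hh.comp measurable_snd).pow_const _)
  have h2q : 0 ≤ 1 - 2 / q := by
    rw [sub_nonneg, div_le_one hq0]; exact hq
  have pt : ∀ t, (∫⁻ s, g (t - s) * h s) ≤
      (∫⁻ s, g (t - s) ^ (q / 2) * h s ^ p) ^ (1 / q) * X ^ (1 / q) * Y ^ (1 - 2 / q) := by
    intro t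
    have hgt : Measurable fun s => g (t - s) := hg.comp (measurable_const.sub measurable_id)
    have hXt : ∫⁻ s, g (t - s) ^ (q / 2) = X :=
      lintegral_sub_left_eq_self (fun s => g s ^ (q / 2)) t
    have := ENNReal.lintegral_prod_norm_pow_le (μ := (volume : Measure ℝ)) (Finset.univ : Finset (Fin 3))
      (f := ![fun s => g (t - s) ^ (q / 2) * h s ^ p, fun s => g (t - s) ^ (q / 2),
        fun s => h s ^ p]) (p := ![1 / q, 1 / q, 1 - 2 / q]) (by
          intro i _
          fin_cases i
          · exact ((hgt.pow_const _).mul (hh.pow_const _)).aemeasurable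
          · exact (hgt.pow_const _).aemeasurable
          · exact (hh.pow_const _).aemeasurable) (by
          simp [Fin.sum_univ_three]; ring) (by
          intro i _
          fin_cases i
          · simp; positivity
          · simp; positivity
          · simpa using h2q)
    simp only [Fin.prod_univ_three, Matrix.cons_val_zero, Matrix.cons_val_one, Matrix.cons_val] at this
    rw [hXt] at this
    refine le_trans (le_of_eq ?_) this
    refine lintegral_congr fun s => ?_
    have hq' : 0 ≤ 1 / q := by positivity
    rw [ENNReal.mul_rpow_of_nonneg _ _ hq', ← ENNReal.rpow_mul, ← ENNReal.rpow_mul,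
      ← ENNReal.rpow_mul]
    calc g (t - s) * h s = g (t - s) ^ (q / 2 * (1 / q) + q / 2 * (1 / q)) *
          h s ^ (p * (1 / q) + p * (1 - 2 / q)) := by
          rw [show q / 2 * (1 / q) + q / 2 * (1 / q) = 1 by field_simp; norm_num,
            show p * (1 / q) + p * (1 - 2 / q) = 1 by linear_combination hpqe, ENNReal.rpow_one,
            ENNReal.rpow_one]
      _ = _ := by
          rw [ENNReal.rpow_add_of_nonneg _ _ (by positivity) (by positivity),
            ENNReal.rpow_add_of_nonneg _ _ (by positivity) (by positivity)]
          ring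
  have h1 : ∫⁻ t, (∫⁻ s, g (t - s) * h s) ^ q ≤ (X * Y) * (X * Y ^ (q - 2)) := by
    calc ∫⁻ t, (∫⁻ s, g (t - s) * h s) ^ q
        ≤ ∫⁻ t, (∫⁻ s, g (t - s) ^ (q / 2) * h s ^ p) * (X * Y ^ (q - 2)) := by
          refine lintegral_mono fun t => ?_
          refine (ENNReal.rpow_le_rpow (pt t) hq0.le).trans (le_of_eq ?_)
          rw [ENNReal.mul_rpow_of_nonneg _ _ hq0.le, ENNReal.mul_rpow_of_nonneg _ _ hq0.le,
            ← ENNReal.rpow_mul, ← ENNReal.rpow_mul, ← ENNReal.rpow_mul,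
            one_div_mul_cancel hq0.ne', ENNReal.rpow_one, ENNReal.rpow_one,
            show (1 - 2 / q) * q = q - 2 by field_simp, mul_assoc]
      _ = (∫⁻ t, ∫⁻ s, g (t - s) ^ (q / 2) * h s ^ p) * (X * Y ^ (q - 2)) := by
          rw [lintegral_mul_const _ hG.lintegral_prod_right']
      _ = (X * Y) * (X * Y ^ (q - 2)) := by
          congr 1
          rw [lintegral_lintegral_swap hG.aemeasurable]
          have : ∀ s, ∫⁻ t, g (t - s) ^ (q / 2) * h s ^ p = X * h s ^ p := by
            intro s
            have hgm : Measurable fun t => g (t - s) ^ (q / 2) :=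
              (hg.comp (measurable_id.sub measurable_const)).pow_const _
            rw [lintegral_mul_const _ hgm]
            congr 1
            exact lintegral_sub_right_eq_self (fun t => g t ^ (q / 2)) s
          simp only [this]
          rw [lintegral_const_mul _ (hh.pow_const _)]
  refine (ENNReal.rpow_le_rpow h1 (by positivity)).trans (le_of_eq ?_)
  have e : (X * Y) * (X * Y ^ (q - 2)) = X ^ (2 : ℝ) * Y ^ (q - 1) := by
    rw [show q - 1 = 1 + (q - 2) by ring,
      ENNReal.rpow_add_of_nonneg _ _ (by norm_num) (by linarith), ENNReal.rpow_one,
      ENNReal.rpow_two]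
    ring
  rw [e, ENNReal.mul_rpow_of_nonneg _ _ (by positivity), ← ENNReal.rpow_mul, ← ENNReal.rpow_mul]
  congr 2
  · field_simp
  · have h3 : (q - 1) * (1 / q) = 1 - 1 / q := by field_simp
    rw [eq_div_iff hp0.ne', h3]
    linarith

lemma conj_toReal {Q Qc : ℝ≥0∞} (hQ : 2 ≤ Q) (hQt : Q ≠ ∞) (hc : Q⁻¹ + Qc⁻¹ = 1) :
    Qc ≠ ∞ ∧ Qc.toReal.HolderConjugate Q.toReal := by
  have hQ0 : Q ≠ 0 := by rintro rfl; simp at hQ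
  have hQc0 : Qc ≠ 0 := by rintro rfl; simp at hc
  have hQct : Qc ≠ ∞ := by
    rintro rfl
    simp only [ENNReal.inv_top, add_zero, ENNReal.inv_eq_one] at hc
    subst hc
    norm_num at hQ
  refine ⟨hQct, ?_⟩
  have h2 : 2 ≤ Q.toReal := by
    have := ENNReal.toReal_mono hQt hQ
    simpa using this
  have h3 : Q.toReal⁻¹ + Qc.toReal⁻¹ = 1 := by
    have := congrArg ENNReal.toReal hc
    rwa [ENNReal.toReal_add (by simpa using hQ0) (by simpa using hQc0), ENNReal.toReal_inv,
      ENNReal.toReal_inv, ENNReal.toReal_one] at this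
  exact (Real.holderConjugate_iff.2 ⟨by linarith, h3⟩).symm

lemma young {Q Qc : ℝ≥0∞} (hQ : 2 ≤ Q) (hc : Q⁻¹ + Qc⁻¹ = 1) {g h : ℝ → ℝ≥0∞}
    (hg : Measurable g) (hh : Measurable h) :
    LpE volume Q (fun t => ∫⁻ s, g (t - s) * h s) ≤
      LpE volume (Q / 2) g * LpE volume Qc h := by
  by_cases hQt : Q = ∞
  · subst hQt
    have hQc : Qc = 1 := by simpa using hc
    subst hQc
    have : (∞ : ℝ≥0∞) / 2 = ∞ := ENNReal.top_div_of_ne_top (by simp)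
    simp only [LpE, this, if_true, ENNReal.one_ne_top, if_false, ENNReal.toReal_one,
      ENNReal.rpow_one, div_one]
    refine essSup_le_of_ae_le _ (Filter.Eventually.of_forall fun t => ?_)
    simp only
    rw [← lintegral_const_mul _ hh]
    refine lintegral_mono_ae ?_
    have h1 := (quasiMeasurePreserving_sub_left_of_right_invariant volume t).ae
      (ENNReal.ae_le_essSup (μ := (volume : Measure ℝ)) g)
    filter_upwards [h1] with s hs
    gcongr
  · obtain ⟨hQct, hconj⟩ := conj_toReal hQ hQt hc
    have h2 : Q / 2 ≠ ∞ := ENNReal.div_ne_top hQt (by simp)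
    simp only [LpE, if_neg hQt, if_neg hQct, if_neg h2, ENNReal.toReal_div]
    have := young_fin hconj (by simpa using ENNReal.toReal_mono hQt hQ) hg hh
    simpa using this

lemma dyadic_bound {r e : ℝ} {G F : ℝ → ℝ≥0∞} (hGm : Measurable G)
    (hG : ∀ l : ℝ≥0∞, l ≠ 0 → l ≠ ∞ → volume {x | l < G x} ≤ l ^ (-r))
    {y l : ℝ≥0∞} (hy0 : y ≠ 0) (hyt : y ≠ ∞) (hl0 : l ≠ 0) (hlt : l ≠ ∞)
    (hF : ∀ x, F x ≤ ∑' n : ℕ, {x | y ^ n * l / 4 < G x}.indicator (fun _ => (y ^ n * l) ^ e) x) :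
    ∫⁻ x, F x ≤ 4 ^ r * (1 - y ^ (e - r))⁻¹ * l ^ (e - r) := by
  have hms : ∀ n : ℕ, MeasurableSet {x | y ^ n * l / 4 < G x} := fun n =>
    measurableSet_lt measurable_const hGm
  calc ∫⁻ x, F x ≤ ∫⁻ x, ∑' n : ℕ,
        {x | y ^ n * l / 4 < G x}.indicator (fun _ => (y ^ n * l) ^ e) x := lintegral_mono hF
    _ = ∑' n : ℕ, (y ^ n * l) ^ e * volume {x | y ^ n * l / 4 < G x} := by
        rw [lintegral_tsum fun n => (measurable_const.indicator (hms n)).aemeasurable]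
        congr 1
        ext n
        rw [lintegral_indicator_const (hms n)]
    _ ≤ ∑' n : ℕ, 4 ^ r * l ^ (e - r) * (y ^ (e - r)) ^ n := by
        refine ENNReal.tsum_le_tsum fun n => ?_
        have hc0 : y ^ n * l ≠ 0 := mul_ne_zero (pow_ne_zero _ hy0) hl0
        have hct : y ^ n * l ≠ ∞ := ENNReal.mul_ne_top (ENNReal.pow_ne_top hyt) hlt
        have h4 : (4 : ℝ≥0∞)⁻¹ ≠ 0 := by simp
        have h1 := hG (y ^ n * l / 4) (by simp [ENNReal.div_eq_zero_iff, hc0])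
          (ENNReal.div_ne_top hct (by simp))
        calc (y ^ n * l) ^ e * volume {x | y ^ n * l / 4 < G x}
            ≤ (y ^ n * l) ^ e * (y ^ n * l / 4) ^ (-r) := by gcongr
          _ = (y ^ n * l) ^ e * ((y ^ n * l) ^ (-r) * 4 ^ r) := by
              rw [div_eq_mul_inv, ENNReal.mul_rpow_of_ne_zero hc0 h4, ENNReal.inv_rpow,
                ENNReal.rpow_neg 4 r, inv_inv]
          _ = (y ^ n * l) ^ (e - r) * 4 ^ r := by
              rw [← mul_assoc, ← ENNReal.rpow_add _ _ hc0 hct, sub_eq_add_neg]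
          _ = 4 ^ r * l ^ (e - r) * (y ^ (e - r)) ^ n := by
              rw [ENNReal.mul_rpow_of_ne_zero (pow_ne_zero _ hy0) hl0, ← ENNReal.rpow_natCast,
                ← ENNReal.rpow_natCast, ← ENNReal.rpow_mul, ← ENNReal.rpow_mul, mul_comm (n : ℝ)]
              ring
          _ ≤ _ := le_rfl
    _ = _ := by
        rw [ENNReal.tsum_mul_left, ENNReal.tsum_geometric]
        ring

lemma weak_high {r : ℝ} {G : ℝ → ℝ≥0∞} (hGm : Measurable G)
    (hG : ∀ l : ℝ≥0∞, l ≠ 0 → l ≠ ∞ → volume {x | l < G x} ≤ l ^ (-r))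
    {l : ℝ≥0∞} (hl0 : l ≠ 0) (hlt : l ≠ ∞) :
    ∫⁻ x, {x | l < G x}.indicator G x ≤
      4 ^ r * (1 - 2 ^ (1 - r))⁻¹ * (2 * l) ^ (1 - r) := by
  refine dyadic_bound (y := 2) hGm hG (by simp) (by simp) (by simp [hl0])
    (ENNReal.mul_ne_top (by simp) hlt) ?_
  intro x
  by_cases hx : l < G x
  swap
  · rw [Set.indicator_of_notMem (by exact hx)]
    exact zero_le
  rw [Set.indicator_of_mem (by exact hx)]
  have h24 : ∀ z : ℝ≥0∞, z * 2 / 4 = z / 2 := by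
    intro z
    rw [show (4 : ℝ≥0∞) = 2 * 2 by norm_num]
    exact ENNReal.mul_div_mul_right z 2 (by simp) (by simp)
  have hhalf : ∀ n : ℕ, (2 : ℝ≥0∞) ^ n * (2 * l) / 4 = 2 ^ n * l / 2 := by
    intro n
    rw [← h24]; congr 1; ring
  simp only [hhalf, ENNReal.rpow_one]
  by_cases hxt : G x = ∞
  · have : (∑' _ : ℕ, l) ≤ ∑' n : ℕ,
        {x | 2 ^ n * l / 2 < G x}.indicator (fun _ => 2 ^ n * (2 * l)) x := by
      refine ENNReal.tsum_le_tsum fun n => ?_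
      rw [Set.indicator_of_mem]
      · rw [← mul_assoc]
        refine le_mul_of_one_le_left' ?_
        calc (1 : ℝ≥0∞) = 1 * 1 := by simp
          _ ≤ _ := by
            gcongr
            · exact one_le_pow₀ (by norm_num)
            · norm_num
      · change _ < G x
        rw [hxt]
        exact (ENNReal.div_ne_top (ENNReal.mul_ne_top (by simp) hlt) (by simp)).lt_top
    rw [ENNReal.tsum_const_eq_top_of_ne_zero hl0] at this
    rw [top_le_iff.1 this]
    exact le_top
  · have hl' : 0 < l.toReal := ENNReal.toReal_pos hl0 hlt
    have hlG : l.toReal ≤ (G x).toReal := ENNReal.toReal_mono hxt hx.le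
    obtain ⟨n, hn1, hn2⟩ := exists_nat_pow_near (x := (G x).toReal / l.toReal) (y := 2)
      (by rwa [one_le_div hl']) (by norm_num)
    rw [le_div_iff₀ hl'] at hn1
    rw [div_lt_iff₀ hl'] at hn2
    refine le_trans ?_ (ENNReal.le_tsum n)
    have hne : (2 : ℝ≥0∞) ^ n * l ≠ ∞ := ENNReal.mul_ne_top (by simp) hlt
    have h1 : 2 ^ n * l ≤ G x := by
      rw [← ENNReal.toReal_le_toReal hne hxt]
      simpa using hn1
    have h2 : G x ≤ 2 ^ n * (2 * l) := by
      rw [← ENNReal.toReal_le_toReal hxt (ENNReal.mul_ne_top (by simp)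
        (ENNReal.mul_ne_top (by simp) hlt))]
      simp only [ENNReal.toReal_mul, ENNReal.toReal_pow, ENNReal.toReal_ofNat]
      rw [pow_succ] at hn2
      linarith
    rw [Set.indicator_of_mem]
    · exact h2
    · change _ < G x
      refine lt_of_lt_of_le (ENNReal.half_lt_self ?_ hne) h1
      exact mul_ne_zero (by simp) hl0

lemma weak_low {r q : ℝ} (hq : 0 < q) {G : ℝ → ℝ≥0∞} (hGm : Measurable G)
    (hG : ∀ l : ℝ≥0∞, l ≠ 0 → l ≠ ∞ → volume {x | l < G x} ≤ l ^ (-r))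
    {l : ℝ≥0∞} (hl0 : l ≠ 0) (hlt : l ≠ ∞) :
    ∫⁻ x, {x | G x ≤ l}.indicator G x ^ q ≤
      4 ^ r * (1 - 2⁻¹ ^ (q - r))⁻¹ * l ^ (q - r) := by
  refine dyadic_bound (y := 2⁻¹) hGm hG (by simp) (by simp) hl0 hlt ?_
  intro x
  by_cases hx : G x ≤ l
  swap
  · rw [Set.indicator_of_notMem (by exact hx)]
    simp [hq]
  rw [Set.indicator_of_mem (by exact hx)]
  by_cases hx0 : G x = 0
  · simp [hx0, hq]
  have hxt : G x ≠ ∞ := ne_top_of_le_ne_top hlt hx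
  have hl' : 0 < l.toReal := ENNReal.toReal_pos hl0 hlt
  have hG' : 0 < (G x).toReal := ENNReal.toReal_pos hx0 hxt
  have hlG : (G x).toReal ≤ l.toReal := ENNReal.toReal_mono hlt hx
  obtain ⟨n, hn1, hn2⟩ := exists_nat_pow_near_of_lt_one (x := (G x).toReal / l.toReal) (y := 2⁻¹)
    (by positivity) (by rwa [div_le_one hl']) (by norm_num) (by norm_num)
  rw [lt_div_iff₀ hl'] at hn1
  rw [div_le_iff₀ hl'] at hn2
  refine le_trans ?_ (ENNReal.le_tsum n)
  have hne : (2⁻¹ : ℝ≥0∞) ^ n * l ≠ ∞ := ENNReal.mul_ne_top (by simp) hlt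
  rw [Set.indicator_of_mem]
  · refine ENNReal.rpow_le_rpow ?_ hq.le
    rw [← ENNReal.toReal_le_toReal hxt hne]
    simpa using hn2
  · change _ < G x
    rw [← ENNReal.toReal_lt_toReal (ENNReal.div_ne_top hne (by simp)) hxt]
    simp only [ENNReal.toReal_div, ENNReal.toReal_mul, ENNReal.toReal_pow, ENNReal.toReal_inv,
      ENNReal.toReal_ofNat]
    rw [pow_succ] at hn1
    have : 0 < (2⁻¹ : ℝ) ^ n * l.toReal := by positivity
    linarith

/-- The key one-sided estimate. -/
lemma trunc_bound {p q : ℝ} (hpq : p.HolderConjugate q) (hq : 2 < q) :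
    ∃ K : ℝ≥0∞, K ≠ ∞ ∧ ∀ (G H : ℝ → ℝ≥0∞), Measurable G → Measurable H →
      (∀ l : ℝ≥0∞, l ≠ 0 → l ≠ ∞ → volume {x | l < G x} ≤ l ^ (-(q / 2))) →
      ∫⁻ y, H y ^ p ≤ 1 → ∀ a : ℝ≥0∞,
      ∫⁻ y, G y * {y | H y ≤ a}.indicator H y ≤ K * a ^ (p - 1) := by
  have hq0 : 0 < q := hpq.symm.pos
  have hp0 : 0 < p := hpq.pos
  have hp1 : 1 < p := hpq.lt
  set K1 : ℝ≥0∞ := 4 ^ (q / 2) * (1 - 2 ^ (1 - q / 2))⁻¹ with hK1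
  set K2 : ℝ≥0∞ := 4 ^ (q / 2) * (1 - 2⁻¹ ^ (q - q / 2))⁻¹ with hK2
  have hK1t : K1 ≠ ∞ := by
    refine ENNReal.mul_ne_top (ENNReal.rpow_ne_top_of_nonneg (by positivity) (by simp)) ?_
    rw [ENNReal.inv_ne_top, ← pos_iff_ne_zero, tsub_pos_iff_lt]
    exact ENNReal.rpow_lt_one_of_one_lt_of_neg (by norm_num) (by linarith)
  have hK2t : K2 ≠ ∞ := by
    refine ENNReal.mul_ne_top (ENNReal.rpow_ne_top_of_nonneg (by positivity) (by simp)) ?_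
    rw [ENNReal.inv_ne_top, ← pos_iff_ne_zero, tsub_pos_iff_lt]
    exact ENNReal.rpow_lt_one (by norm_num) (by linarith)
  refine ⟨K1 * 2 ^ (1 - q / 2) + K2 ^ (1 / q) + 1, ?_, ?_⟩
  · refine ENNReal.add_ne_top.2 ⟨ENNReal.add_ne_top.2 ⟨ENNReal.mul_ne_top hK1t ?_, ?_⟩, by simp⟩
    · exact ENNReal.rpow_ne_top_of_ne_zero (by simp) (by simp)
    · exact ENNReal.rpow_ne_top_of_nonneg (by positivity) hK2t
  intro G H hG hH hw hHp a
  by_cases ha0 : a = 0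
  · have : ∀ y, G y * {y | H y ≤ a}.indicator H y = 0 := by
      intro y
      by_cases hy : H y ≤ a
      · rw [Set.indicator_of_mem (by exact hy)]
        rw [ha0] at hy
        simp [le_zero_iff.1 hy]
      · rw [Set.indicator_of_notMem (by exact hy), mul_zero]
    simp [this]
  by_cases hat : a = ∞
  · rw [hat, ENNReal.top_rpow_of_pos (by linarith), ENNReal.mul_top]
    · exact le_top
    · simp
  set l := a ^ (2 * (p - 1)) with hl
  have hl0 : l ≠ 0 := by simp [hl, ENNReal.rpow_eq_zero_iff, ha0, hat]
  have hlt : l ≠ ∞ := ENNReal.rpow_ne_top_of_ne_zero ha0 hat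
  have hmul : (p - 1) * q = p := hpq.sub_one_mul_conj
  have hms1 : MeasurableSet {x | l < G x} := measurableSet_lt measurable_const hG
  have hms2 : MeasurableSet {x | G x ≤ l} := measurableSet_le hG measurable_const
  have pt : ∀ y, G y * {y | H y ≤ a}.indicator H y ≤
      {x | l < G x}.indicator G y * a + {x | G x ≤ l}.indicator G y * H y := by
    intro y
    have h1 : {y | H y ≤ a}.indicator H y ≤ a := by
      by_cases hy : H y ≤ a
      · rw [Set.indicator_of_mem (by exact hy)]; exact hy
      · rw [Set.indicator_of_notMem (by exact hy)]; exact zero_le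
    have h2 : {y | H y ≤ a}.indicator H y ≤ H y := Set.indicator_le_self _ _ _
    by_cases hy : l < G y
    · rw [Set.indicator_of_mem (s := {x | l < G x}) (by exact hy)]
      exact le_add_right (by gcongr)
    · rw [Set.indicator_of_mem (s := {x | G x ≤ l}) (by exact not_lt.1 hy)]
      exact le_add_left (by gcongr)
  have b1 : ∫⁻ y, {x | l < G x}.indicator G y * a ≤ K1 * 2 ^ (1 - q / 2) * a ^ (p - 1) := by
    rw [lintegral_mul_const _ (hG.indicator hms1)]
    calc _ ≤ (K1 * (2 * l) ^ (1 - q / 2)) * a := by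
          gcongr; exact weak_high hG hw hl0 hlt
      _ = K1 * 2 ^ (1 - q / 2) * (a ^ (2 * (p - 1) * (1 - q / 2)) * a ^ (1 : ℝ)) := by
          rw [ENNReal.mul_rpow_of_ne_zero (by simp) hl0, hl, ← ENNReal.rpow_mul, ENNReal.rpow_one]
          ring
      _ = _ := by
          rw [← ENNReal.rpow_add _ _ ha0 hat]
          congr 2
          linear_combination -hmul
  have b2 : ∫⁻ y, {x | G x ≤ l}.indicator G y * H y ≤ K2 ^ (1 / q) * a ^ (p - 1) := by
    calc _ ≤ (∫⁻ y, {x | G x ≤ l}.indicator G y ^ q) ^ (1 / q) * (∫⁻ y, H y ^ p) ^ (1 / p) :=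
          ENNReal.lintegral_mul_le_Lp_mul_Lq volume hpq.symm (hG.indicator hms2).aemeasurable
            hH.aemeasurable
      _ ≤ (K2 * l ^ (q - q / 2)) ^ (1 / q) * 1 := by
          gcongr
          · exact weak_low hq0 hG hw hl0 hlt
          · exact ENNReal.rpow_le_one hHp (by positivity)
      _ = _ := by
          rw [mul_one, ENNReal.mul_rpow_of_nonneg _ _ (by positivity), hl, ← ENNReal.rpow_mul,
            ← ENNReal.rpow_mul]
          congr 2
          field_simp
          norm_num
  calc _ ≤ _ := lintegral_mono pt
    _ = _ := lintegral_add_left ((hG.indicator hms1).mul_const _) _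
    _ ≤ _ := add_le_add b1 b2
    _ ≤ _ := by
      rw [← add_mul]
      exact mul_le_mul_left le_self_add _

lemma weak_comp {G : ℝ → ℝ≥0∞} (hGm : Measurable G) {e : ℝ → ℝ}
    (he : MeasurePreserving e volume volume) {r : ℝ}
    (hw : ∀ l : ℝ≥0∞, l ≠ 0 → l ≠ ∞ → volume {x | l < G x} ≤ l ^ (-r)) :
    ∀ l : ℝ≥0∞, l ≠ 0 → l ≠ ∞ → volume {x | l < G (e x)} ≤ l ^ (-r) := by
  intro l h0 ht
  have := he.measure_preimage (s := {x | l < G x})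
    (measurableSet_lt measurable_const hGm).nullMeasurableSet
  refine le_trans (le_of_eq ?_) (hw l h0 ht)
  rw [← this]
  rfl

lemma trilinear_norm {p q : ℝ} (hpq : p.HolderConjugate q) (hq : 2 < q) :
    ∃ K : ℝ≥0∞, K ≠ ∞ ∧ ∀ (f G H : ℝ → ℝ≥0∞), Measurable f → Measurable G → Measurable H →
      (∀ l : ℝ≥0∞, l ≠ 0 → l ≠ ∞ → volume {x | l < G x} ≤ l ^ (-(q / 2))) →
      ∫⁻ y, H y ^ p ≤ 1 → ∫⁻ y, f y ^ p ≤ 1 →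
      ∫⁻ x, f x * ∫⁻ y, G (x - y) * H y ≤ K := by
  obtain ⟨K, hK, hb⟩ := trunc_bound hpq hq
  have hp1 : 1 < p := hpq.lt
  refine ⟨K + K, ENNReal.add_ne_top.2 ⟨hK, hK⟩, ?_⟩
  intro f G H hf hG hH hw hHp hfp
  have hG1 : ∀ x, Measurable fun y => G (x - y) := fun x =>
    hG.comp (measurable_const.sub measurable_id)
  have hG2 : ∀ y, Measurable fun x => G (x - y) := fun y =>
    hG.comp (measurable_id.sub measurable_const)
  have hGp : Measurable fun z : ℝ × ℝ => G (z.1 - z.2) :=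
    hG.comp (measurable_fst.sub measurable_snd)
  have hind1 : Measurable fun z : ℝ × ℝ =>
      f z.1 * (G (z.1 - z.2) * {y | H y ≤ f z.1}.indicator H z.2) := by
    have : (fun z : ℝ × ℝ => {y | H y ≤ f z.1}.indicator H z.2) =
        {z : ℝ × ℝ | H z.2 ≤ f z.1}.indicator (fun z => H z.2) := by
      ext z; simp [Set.indicator_apply]
    refine (hf.comp measurable_fst).mul (hGp.mul ?_)
    rw [this]
    exact (hH.comp measurable_snd).indicator
      (measurableSet_le (hH.comp measurable_snd) (hf.comp measurable_fst))
  have hind2 : Measurable fun z : ℝ × ℝ =>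
      H z.2 * (G (z.1 - z.2) * {x | f x ≤ H z.2}.indicator f z.1) := by
    have : (fun z : ℝ × ℝ => {x | f x ≤ H z.2}.indicator f z.1) =
        {z : ℝ × ℝ | f z.1 ≤ H z.2}.indicator (fun z => f z.1) := by
      ext z; simp [Set.indicator_apply]
    refine (hH.comp measurable_snd).mul (hGp.mul ?_)
    rw [this]
    exact (hf.comp measurable_fst).indicator
      (measurableSet_le (hf.comp measurable_fst) (hH.comp measurable_snd))
  have hpow : ∀ z : ℝ≥0∞, z * (K * z ^ (p - 1)) = K * z ^ p := by
    intro z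
    conv_rhs => rw [show p = (p - 1) + 1 by ring,
      ENNReal.rpow_add_of_nonneg _ _ (by linarith) (by norm_num), ENNReal.rpow_one]
    ring
  have pt : ∀ x y, f x * (G (x - y) * H y) ≤
      f x * (G (x - y) * {y | H y ≤ f x}.indicator H y) +
      H y * (G (x - y) * {x | f x ≤ H y}.indicator f x) := by
    intro x y
    rcases le_total (H y) (f x) with h | h
    · rw [Set.indicator_of_mem (s := {y | H y ≤ f x}) (by exact h)]
      exact le_self_add
    · rw [Set.indicator_of_mem (s := {x | f x ≤ H y}) (by exact h)]
      refine le_add_left (le_of_eq ?_)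
      ring
  calc ∫⁻ x, f x * ∫⁻ y, G (x - y) * H y
      = ∫⁻ x, ∫⁻ y, f x * (G (x - y) * H y) := by
        refine lintegral_congr fun x => ?_
        rw [lintegral_const_mul _ ((hG1 x).fun_mul hH)]
    _ ≤ ∫⁻ x, ∫⁻ y, (f x * (G (x - y) * {y | H y ≤ f x}.indicator H y) +
          H y * (G (x - y) * {x | f x ≤ H y}.indicator f x)) :=
        lintegral_mono fun x => lintegral_mono fun y => pt x y
    _ = (∫⁻ x, ∫⁻ y, f x * (G (x - y) * {y | H y ≤ f x}.indicator H y)) +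
          ∫⁻ x, ∫⁻ y, H y * (G (x - y) * {x | f x ≤ H y}.indicator f x) := by
        rw [← lintegral_add_left hind1.lintegral_prod_right']
        refine lintegral_congr fun x => ?_
        exact lintegral_add_left (hind1.comp measurable_prodMk_left) _
    _ ≤ K + K := by
        refine add_le_add ?_ ?_
        · calc _ ≤ ∫⁻ x, K * f x ^ p := by
                refine lintegral_mono fun x => ?_
                have hms : MeasurableSet {y | H y ≤ f x} := measurableSet_le hH measurable_const
                simp only
                rw [lintegral_const_mul _ ((hG1 x).fun_mul (hH.indicator hms)), ← hpow]
                gcongr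
                exact hb _ H (hG1 x) hH
                  (weak_comp hG (Measure.measurePreserving_sub_left volume x) hw) hHp _
            _ = K * ∫⁻ x, f x ^ p := lintegral_const_mul _ (hf.pow_const _)
            _ ≤ K * 1 := by gcongr
            _ = K := mul_one _
        · rw [lintegral_lintegral_swap hind2.aemeasurable]
          calc _ ≤ ∫⁻ y, K * H y ^ p := by
                refine lintegral_mono fun y => ?_
                have hms : MeasurableSet {x | f x ≤ H y} := measurableSet_le hf measurable_const
                simp only
                rw [lintegral_const_mul _ ((hG2 y).fun_mul (hf.indicator hms)), ← hpow]
                gcongr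
                exact hb _ f (hG2 y) hf
                  (weak_comp hG (measurePreserving_sub_right volume y) hw) hfp _
            _ = K * ∫⁻ x, H x ^ p := lintegral_const_mul _ (hH.pow_const _)
            _ ≤ K * 1 := by gcongr
            _ = K := mul_one _

lemma normalize_lp {p : ℝ} (hp : 0 < p) {f : ℝ → ℝ≥0∞} {N : ℝ≥0∞}
    (hN : N = (∫⁻ x, f x ^ p) ^ (1 / p)) (hN0 : N ≠ 0) (hNt : N ≠ ∞) :
    ∫⁻ x, (N⁻¹ * f x) ^ p ≤ 1 := by
  have : ∀ x, (N⁻¹ * f x) ^ p = (N ^ p)⁻¹ * f x ^ p := by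
    intro x
    rw [ENNReal.mul_rpow_of_nonneg _ _ hp.le, ENNReal.inv_rpow]
  simp only [this]
  have h0 : N ^ p ≠ 0 := by simp [ENNReal.rpow_eq_zero_iff, hN0, hNt]
  have ht : N ^ p ≠ ∞ := ENNReal.rpow_ne_top_of_nonneg hp.le hNt
  rw [lintegral_const_mul' _ _ (by simpa using h0)]
  have e : ∫⁻ x, f x ^ p = N ^ p := by
    rw [hN, ← ENNReal.rpow_mul, one_div_mul_cancel hp.ne', ENNReal.rpow_one]
  rw [e, ENNReal.inv_mul_cancel h0 ht]

lemma ae_zero_of_norm {p : ℝ} (hp : 0 < p) {f : ℝ → ℝ≥0∞} (hf : Measurable f)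
    (h : (∫⁻ x, f x ^ p) ^ (1 / p) = 0) : ∀ᵐ x, f x = 0 := by
  have hp' : 0 < 1 / p := by positivity
  rw [ENNReal.rpow_eq_zero_iff_of_pos hp', lintegral_eq_zero_iff (hf.pow_const p)] at h
  filter_upwards [h] with x hx
  simpa [ENNReal.rpow_eq_zero_iff, hp, hp.not_gt] using hx

lemma wk_meas {r : ℝ} {G : ℝ → ℝ≥0∞} {l : ℝ≥0∞} (hlt : l ≠ ∞) :
    l * (volume {x | l < G x}) ^ (1 / r) ≤ wkLp r G := by
  lift l to ℝ≥0 using hlt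
  exact le_iSup (fun lam : ℝ≥0 => (lam : ℝ≥0∞) *
    (volume {k : ℝ | (lam : ℝ≥0∞) < G k}) ^ (1 / r)) l

lemma trilinear {p q : ℝ} (hpq : p.HolderConjugate q) (hq : 2 < q) :
    ∃ K : ℝ≥0∞, K ≠ ∞ ∧ ∀ (f G H : ℝ → ℝ≥0∞), Measurable f → Measurable G → Measurable H →
      wkLp (q / 2) G ≠ ∞ → ∫⁻ y, H y ^ p ≠ ∞ → ∫⁻ y, f y ^ p ≠ ∞ →
      ∫⁻ x, f x * ∫⁻ y, G (x - y) * H y ≤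
        K * wkLp (q / 2) G * (∫⁻ y, H y ^ p) ^ (1 / p) * (∫⁻ y, f y ^ p) ^ (1 / p) := by
  obtain ⟨K, hK, hb⟩ := trilinear_norm hpq hq
  have hp0 : 0 < p := hpq.pos
  have hr : 0 < q / 2 := by linarith
  refine ⟨K, hK, ?_⟩
  intro f G H hf hG hH hA hB hF
  set A := wkLp (q / 2) G with hAdef
  set B := (∫⁻ y, H y ^ p) ^ (1 / p) with hBdef
  set N := (∫⁻ y, f y ^ p) ^ (1 / p) with hNdef
  have hBt : B ≠ ∞ := ENNReal.rpow_ne_top_of_nonneg (by positivity) hB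
  have hNt : N ≠ ∞ := ENNReal.rpow_ne_top_of_nonneg (by positivity) hF
  have hzero : (∀ᵐ x, f x * ∫⁻ y, G (x - y) * H y = 0) →
      ∫⁻ x, f x * ∫⁻ y, G (x - y) * H y ≤ K * A * B * N := by
    intro h
    rw [lintegral_congr_ae h]
    simp
  by_cases hN0 : N = 0
  · refine hzero ?_
    filter_upwards [ae_zero_of_norm hp0 hf hN0] with x hx
    simp [hx]
  by_cases hB0 : B = 0
  · refine hzero (Filter.Eventually.of_forall fun x => ?_)
    have h1 : ∀ᵐ y, G (x - y) * H y = 0 := by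
      filter_upwards [ae_zero_of_norm hp0 hH hB0] with y hy
      simp [hy]
    rw [lintegral_congr_ae h1]
    simp
  by_cases hA0 : A = 0
  · have hGz : ∀ᵐ x, G x = 0 := by
      have h1 : ∀ n : ℕ, ∀ᵐ x, G x ≤ ((n : ℝ≥0∞) + 1)⁻¹ := by
        intro n
        have h2 := wk_meas (G := G) (r := q / 2) (l := ((n : ℝ≥0∞) + 1)⁻¹) (by simp)
        rw [← hAdef, hA0, nonpos_iff_eq_zero, mul_eq_zero] at h2
        rcases h2 with h2 | h2
        · simp at h2
        · rw [ENNReal.rpow_eq_zero_iff_of_pos (by positivity)] at h2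
          rw [ae_iff]
          simpa only [not_le] using h2
      filter_upwards [ae_all_iff.2 h1] with x hx
      by_contra hne
      obtain ⟨n, hn⟩ := ENNReal.exists_inv_nat_lt hne
      have h3 : ((n : ℝ≥0∞) + 1)⁻¹ ≤ (n : ℝ≥0∞)⁻¹ := by
        rw [ENNReal.inv_le_inv]; exact le_self_add
      exact absurd (hx n) (not_le.2 (h3.trans_lt hn))
    refine hzero (Filter.Eventually.of_forall fun x => ?_)
    have h1 : ∀ᵐ y, G (x - y) * H y = 0 := by
      filter_upwards [(quasiMeasurePreserving_sub_left_of_right_invariant volume x).ae hGz] with y hy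
      simp [hy]
    rw [lintegral_congr_ae h1]
    simp
  have hw : ∀ l : ℝ≥0∞, l ≠ 0 → l ≠ ∞ → volume {x | l < A⁻¹ * G x} ≤ l ^ (-(q / 2)) := by
    intro l hl0 hlt
    have hset : {x | l < A⁻¹ * G x} = {x | A * l < G x} := by
      ext x
      change l < A⁻¹ * G x ↔ A * l < G x
      conv_rhs => rw [← ENNReal.mul_lt_mul_iff_right (a := A⁻¹) (by simpa using hA)
        (by simpa using hA0), ← mul_assoc, ENNReal.inv_mul_cancel hA0 hA, one_mul]
    rw [hset]
    have h1 := wk_meas (G := G) (r := q / 2) (l := A * l) (ENNReal.mul_ne_top hA hlt)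
    rw [← hAdef, mul_assoc] at h1
    have h2 : l * volume {x | A * l < G x} ^ (1 / (q / 2)) ≤ 1 := by
      rw [← ENNReal.mul_le_mul_iff_right (a := A) hA0 hA, mul_one]
      exact h1
    have h3 : volume {x | A * l < G x} ^ (1 / (q / 2)) ≤ l⁻¹ := by
      rw [← one_div, ENNReal.le_div_iff_mul_le (Or.inl hl0) (Or.inl hlt), mul_comm]
      exact h2
    calc _ = (volume {x | A * l < G x} ^ (1 / (q / 2))) ^ (q / 2) := by
          rw [← ENNReal.rpow_mul, one_div_mul_cancel hr.ne', ENNReal.rpow_one]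
      _ ≤ (l⁻¹) ^ (q / 2) := by gcongr
      _ = _ := by rw [ENNReal.inv_rpow, ENNReal.rpow_neg]
  have h1 := hb (fun x => N⁻¹ * f x) (fun x => A⁻¹ * G x) (fun x => B⁻¹ * H x)
    (hf.const_mul _) (hG.const_mul _) (hH.const_mul _) hw
    (normalize_lp hp0 hBdef hB0 hBt) (normalize_lp hp0 hNdef hN0 hNt)
  have h2 : ∫⁻ x, f x * ∫⁻ y, G (x - y) * H y =
      (A * B * N) * ∫⁻ x, N⁻¹ * f x * ∫⁻ y, A⁻¹ * G (x - y) * (B⁻¹ * H y) := by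
    have hABN : A * B * N ≠ ∞ := ENNReal.mul_ne_top (ENNReal.mul_ne_top hA hBt) hNt
    rw [← lintegral_const_mul' _ _ hABN]
    refine lintegral_congr fun x => ?_
    have h3 : ∀ y, A⁻¹ * G (x - y) * (B⁻¹ * H y) = (A⁻¹ * B⁻¹) * (G (x - y) * H y) :=
      fun y => by ring
    simp only [h3]
    rw [lintegral_const_mul' _ _ (ENNReal.mul_ne_top (by simpa using hA0) (by simpa using hB0))]
    calc _ = (A * A⁻¹) * (B * B⁻¹) * (N * N⁻¹) * (f x * ∫⁻ y, G (x - y) * H y) := by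
          rw [ENNReal.mul_inv_cancel hA0 hA, ENNReal.mul_inv_cancel hB0 hBt,
            ENNReal.mul_inv_cancel hN0 hNt]
          simp
      _ = _ := by ring
  rw [h2]
  calc _ ≤ (A * B * N) * K := by gcongr
    _ = _ := by ring

/-- Weak Young (Hardy-Littlewood-Sobolev) inequality. -/
lemma weak_young {p q : ℝ} (hpq : p.HolderConjugate q) (hq : 2 < q) :
    ∃ K : ℝ≥0∞, K ≠ ∞ ∧ ∀ (G H : ℝ → ℝ≥0∞), Measurable G → Measurable H →
      wkLp (q / 2) G ≠ ∞ → ∫⁻ y, H y ^ p ≠ ∞ →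
      (∫⁻ x, (∫⁻ y, G (x - y) * H y) ^ q) ^ (1 / q) ≤
        K * wkLp (q / 2) G * (∫⁻ y, H y ^ p) ^ (1 / p) := by
  obtain ⟨K, hK, hb⟩ := trilinear hpq hq
  refine ⟨K, hK, ?_⟩
  intro G H hG hH hA hB
  refine dual_bound hpq ?_ ?_
  · exact ((hG.comp (measurable_fst.sub measurable_snd)).mul
      (hH.comp measurable_snd)).lintegral_prod_right'
  · intro f hf hfin
    exact hb f G H hf hG hH hA hB hfin.ne

lemma LpE_mono {P : ℝ≥0∞} {f g : ℝ → ℝ≥0∞} (h : ∀ x, f x ≤ g x) :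
    LpE volume P f ≤ LpE volume P g := by
  unfold LpE
  split_ifs
  · exact essSup_mono_ae (Filter.Eventually.of_forall h)
  · gcongr with x
    exact h x

lemma LpE_const_mul {P : ℝ≥0∞} (hP : P ≠ 0) {c : ℝ≥0∞} (hc : c ≠ ∞) (f : ℝ → ℝ≥0∞) :
    LpE volume P (fun x => c * f x) = c * LpE volume P f := by
  unfold LpE
  split_ifs with hPt
  · exact ENNReal.essSup_const_mul
  · have hp : 0 < P.toReal := ENNReal.toReal_pos hP hPt
    simp only [ENNReal.mul_rpow_of_nonneg _ _ hp.le]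
    rw [lintegral_const_mul' _ _ (ENNReal.rpow_ne_top_of_nonneg hp.le hc),
      ENNReal.mul_rpow_of_nonneg _ _ (by positivity), ← ENNReal.rpow_mul,
      mul_one_div_cancel hp.ne', ENNReal.rpow_one]

lemma prod_step {G H w : ℝ → ℝ≥0∞} (hG : Measurable G) (hH : Measurable H) (hw : Measurable w) :
    ∫⁻ z : ℝ × ℝ, w z.1 * (G (z.1 - z.2) * H z.2) ∂(volume.prod volume) =
      ∫⁻ x, w x * ∫⁻ y, G (x - y) * H y := by
  have hm : Measurable fun z : ℝ × ℝ => w z.1 * (G (z.1 - z.2) * H z.2) := by fun_prop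
  rw [lintegral_prod _ hm.aemeasurable]
  refine lintegral_congr fun x => ?_
  have hm2 : Measurable fun y => G (x - y) * H y := by fun_prop
  exact lintegral_const_mul (w x) hm2

lemma window_bound {Q Qc : ℝ≥0∞} (hQ : 2 ≤ Q) (hc : Q⁻¹ + Qc⁻¹ = 1)
    {ψ : ℝ → ℝ≥0∞} (hψ : Measurable ψ) {M : ℝ≥0∞} (hMt : M ≠ ∞) (hM : ∀ x, ψ x ≤ M)
    {R : ℝ} (hR : ∀ x, ψ x ≠ 0 → |x| ≤ R) (hc0 : ∫⁻ x, ψ x ≠ 0) (hct : ∫⁻ x, ψ x ≠ ∞)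
    {g h : ℝ → ℝ≥0∞} (hg : Measurable g) (hh : Measurable h) (k : ℝ) :
    LpE volume Q (fun t => (∫⁻ s, g (t - s) * h s) * ψ (t - k)) ≤
      ∫⁻ x, (M * (∫⁻ x, ψ x)⁻¹ * (∫⁻ x, ψ x)⁻¹ *
        (Set.Icc (-(3 * R)) (3 * R)).indicator 1 (k - x)) *
        ∫⁻ y, LpE volume (Q / 2) (fun t => g t * ψ (t - (x - y))) *
          LpE volume Qc (fun t => h t * ψ (t - y)) := by
  set c := ∫⁻ x, ψ x with hcdef
  set D := M * c⁻¹ * c⁻¹ with hD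
  set χ : ℝ → ℝ≥0∞ := (Set.Icc (-(3 * R)) (3 * R)).indicator 1 with hχ
  have hDt : D ≠ ∞ := ENNReal.mul_ne_top (ENNReal.mul_ne_top hMt (by simpa using hc0))
    (by simpa using hc0)
  have hχm : Measurable χ := measurable_one.indicator measurableSet_Icc
  have hχt : ∀ x, χ x ≠ ∞ := by
    intro x
    simp only [hχ, Set.indicator_apply]
    split_ifs <;> simp
  have hQ1 : 1 < Q := lt_of_lt_of_le (by norm_num) hQ
  have hQ0 : Q ≠ 0 := (lt_of_lt_of_le (by norm_num) hQ1.le).ne'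
  set u : ℝ → ℝ × ℝ → ℝ≥0∞ := fun t z => D * χ (k - z.1) *
    ∫⁻ s, (g (t - s) * ψ (t - s - (z.1 - z.2))) * (h s * ψ (s - z.2)) with hu
  have hw : Measurable fun a : (ℝ × (ℝ × ℝ)) × ℝ =>
      (g (a.1.1 - a.2) * ψ (a.1.1 - a.2 - (a.1.2.1 - a.1.2.2))) * (h a.2 * ψ (a.2 - a.1.2.2)) := by
    fun_prop
  have hum : Measurable (Function.uncurry u) := by
    have h1 : Measurable fun a : ℝ × (ℝ × ℝ) => D * χ (k - a.2.1) := by fun_prop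
    exact h1.mul hw.lintegral_prod_right'
  have step1 : ∀ t, (∫⁻ s, g (t - s) * h s) * ψ (t - k) ≤
      ∫⁻ z, u t z ∂(volume.prod volume) := by
    intro t
    by_cases htk : ψ (t - k) = 0
    · rw [htk, mul_zero]; exact zero_le
    have h1 := abs_le.1 (hR _ htk)
    have hdrop : ∀ z : ℝ × ℝ, u t z = D *
        ∫⁻ s, (g (t - s) * h s) * (ψ (t - s - (z.1 - z.2)) * ψ (s - z.2)) := by
      intro z
      simp only [hu]
      rw [mul_assoc, ← lintegral_const_mul' _ _ (hχt _)]
      congr 1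
      refine lintegral_congr fun s => ?_
      by_cases ha : ψ (t - s - (z.1 - z.2)) = 0
      · simp [ha]
      by_cases hb : ψ (s - z.2) = 0
      · simp [hb]
      have h2 := abs_le.1 (hR _ ha)
      have h3 := abs_le.1 (hR _ hb)
      have : χ (k - z.1) = 1 := by
        simp only [hχ]
        rw [Set.indicator_of_mem]
        · rfl
        · constructor <;> linarith [h1.1, h1.2, h2.1, h2.2, h3.1, h3.2]
      rw [this]
      ring
    have hz : Measurable fun a : (ℝ × ℝ) × ℝ =>
        (g (t - a.2) * h a.2) * (ψ (t - a.2 - (a.1.1 - a.1.2)) * ψ (a.2 - a.1.2)) := by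
      fun_prop
    have hinner : ∀ s : ℝ, ∫⁻ z : ℝ × ℝ, (g (t - s) * h s) *
        (ψ (t - s - (z.1 - z.2)) * ψ (s - z.2)) ∂(volume.prod volume) =
          (g (t - s) * h s) * (c * c) := by
      intro s
      have hm1 : Measurable fun z : ℝ × ℝ => ψ (t - s - (z.1 - z.2)) * ψ (s - z.2) := by fun_prop
      rw [lintegral_const_mul _ hm1, lintegral_prod_symm' _ hm1]
      congr 1
      have h4 : ∀ y : ℝ, ∫⁻ x, ψ (t - s - (x - y)) * ψ (s - y) = c * ψ (s - y) := by
        intro y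
        have hm2 : Measurable fun x => ψ (t - s - (x - y)) := by fun_prop
        rw [lintegral_mul_const _ hm2]
        congr 1
        have e : ∀ x, t - s - (x - y) = (t - s + y) - x := fun x => by ring
        simp only [e]
        exact lintegral_sub_left_eq_self ψ _
      simp only [h4]
      have hm3 : Measurable fun y => ψ (s - y) := by fun_prop
      rw [lintegral_const_mul _ hm3, lintegral_sub_left_eq_self ψ s]
    have hm0 : Measurable fun s => g (t - s) * h s := by fun_prop
    simp only [hdrop]
    rw [lintegral_const_mul _ hz.lintegral_prod_right', lintegral_lintegral_swap hz.aemeasurable]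
    simp only [hinner]
    rw [lintegral_mul_const _ hm0]
    calc _ ≤ (∫⁻ s, g (t - s) * h s) * M := by gcongr; exact hM _
      _ = M * (c⁻¹ * c) * (c⁻¹ * c) * (∫⁻ s, g (t - s) * h s) := by
          rw [ENNReal.inv_mul_cancel hc0 hct]; ring
      _ = _ := by rw [hD]; ring
  have hGm : Measurable fun x => LpE volume (Q / 2) (fun t => g t * ψ (t - x)) :=
    measurable_LpE (Q / 2) (u := fun t x => g t * ψ (t - x))
      (by simp only [Function.uncurry_def]; fun_prop)
  have hHm : Measurable fun x => LpE volume Qc (fun t => h t * ψ (t - x)) :=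
    measurable_LpE Qc (u := fun t x => h t * ψ (t - x))
      (by simp only [Function.uncurry_def]; fun_prop)
  calc _ ≤ LpE volume Q (fun t => ∫⁻ z, u t z ∂(volume.prod volume)) := LpE_mono step1
    _ ≤ ∫⁻ z, LpE volume Q (fun t => u t z) ∂(volume.prod volume) := minkowski _ hQ1 hum
    _ ≤ ∫⁻ z : ℝ × ℝ, (D * χ (k - z.1)) *
          (LpE volume (Q / 2) (fun t => g t * ψ (t - (z.1 - z.2))) *
          LpE volume Qc (fun t => h t * ψ (t - z.2))) ∂(volume.prod volume) := by
        refine lintegral_mono fun z => ?_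
        simp only [hu]
        rw [LpE_const_mul hQ0 (ENNReal.mul_ne_top hDt (hχt _))]
        have hg' : Measurable fun t => g t * ψ (t - (z.1 - z.2)) := by fun_prop
        have hh' : Measurable fun t => h t * ψ (t - z.2) := by fun_prop
        have hy := young hQ hc hg' hh'
        exact mul_le_mul' le_rfl hy
    _ = _ := prod_step (G := fun x => LpE volume (Q / 2) (fun t => g t * ψ (t - x)))
        (H := fun x => LpE volume Qc (fun t => h t * ψ (t - x)))
        (w := fun x => D * χ (k - x)) hGm hHm (by fun_prop)

lemma amalgam_ennreal {Q Qc : ℝ≥0∞} (hQ : 2 ≤ Q) (hc : Q⁻¹ + Qc⁻¹ = 1)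
    {p q : ℝ} (hpq : p.HolderConjugate q) (hq : 2 < q)
    {ψ : ℝ → ℝ≥0∞} (hψ : Measurable ψ) {M : ℝ≥0∞} (hMt : M ≠ ∞) (hM : ∀ x, ψ x ≤ M)
    {R : ℝ} (hR : ∀ x, ψ x ≠ 0 → |x| ≤ R) (hc0 : ∫⁻ x, ψ x ≠ 0) (hct : ∫⁻ x, ψ x ≠ ∞) :
    ∃ C : ℝ≥0∞, C ≠ ∞ ∧ ∀ g h : ℝ → ℝ≥0∞, Measurable g → Measurable h →
      wkLp (q / 2) (fun k => LpE volume (Q / 2) (fun t => g t * ψ (t - k))) < ∞ →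
      LpE volume (ENNReal.ofReal p) (fun k => LpE volume Qc (fun t => h t * ψ (t - k))) < ∞ →
      LpE volume (ENNReal.ofReal q)
          (fun k => LpE volume Q (fun t => (∫⁻ s, g (t - s) * h s) * ψ (t - k))) ≤
        C * wkLp (q / 2) (fun k => LpE volume (Q / 2) (fun t => g t * ψ (t - k))) *
        LpE volume (ENNReal.ofReal p) (fun k => LpE volume Qc (fun t => h t * ψ (t - k))) := by
  obtain ⟨K, hK, hb⟩ := weak_young hpq hq
  have hq0 : 0 < q := hpq.symm.pos
  have hp0 : 0 < p := hpq.pos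
  set c := ∫⁻ x, ψ x with hcdef
  set D := M * c⁻¹ * c⁻¹ with hD
  set χ : ℝ → ℝ≥0∞ := (Set.Icc (-(3 * R)) (3 * R)).indicator 1 with hχ
  have hDt : D ≠ ∞ := ENNReal.mul_ne_top (ENNReal.mul_ne_top hMt (by simpa using hc0))
    (by simpa using hc0)
  have hχm : Measurable χ := measurable_one.indicator measurableSet_Icc
  have hχt : ∀ x, χ x ≠ ∞ := by
    intro x
    simp only [hχ, Set.indicator_apply]
    split_ifs <;> simp
  have hχi : ∫⁻ w, χ w ≠ ∞ := by
    simp only [hχ]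
    rw [lintegral_indicator_one measurableSet_Icc]
    simp
  refine ⟨D * (∫⁻ w, χ w) * K, ENNReal.mul_ne_top (ENNReal.mul_ne_top hDt hχi) hK, ?_⟩
  intro g h hg hh hA hB
  have hGm : Measurable fun x => LpE volume (Q / 2) (fun t => g t * ψ (t - x)) :=
    measurable_LpE (Q / 2) (u := fun t x => g t * ψ (t - x))
      (by simp only [Function.uncurry_def]; fun_prop)
  have hHm : Measurable fun x => LpE volume Qc (fun t => h t * ψ (t - x)) :=
    measurable_LpE Qc (u := fun t x => h t * ψ (t - x))
      (by simp only [Function.uncurry_def]; fun_prop)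
  have hwin := window_bound hQ hc hψ hMt hM hR hc0 hct hg hh
  set G : ℝ → ℝ≥0∞ := fun x => LpE volume (Q / 2) (fun t => g t * ψ (t - x)) with hG
  set H : ℝ → ℝ≥0∞ := fun x => LpE volume Qc (fun t => h t * ψ (t - x)) with hH
  set T : ℝ → ℝ≥0∞ := fun x => ∫⁻ y, G (x - y) * H y with hT
  have hTm : Measurable T :=
    ((hGm.comp (measurable_fst.sub measurable_snd)).mul
      (hHm.comp measurable_snd)).lintegral_prod_right'
  have hLp : ∀ f : ℝ → ℝ≥0∞, LpE volume (ENNReal.ofReal p) f = (∫⁻ x, f x ^ p) ^ (1 / p) := by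
    intro f
    simp [LpE, ENNReal.toReal_ofReal hp0.le]
  have hLq : ∀ f : ℝ → ℝ≥0∞, LpE volume (ENNReal.ofReal q) f = (∫⁻ x, f x ^ q) ^ (1 / q) := by
    intro f
    simp [LpE, ENNReal.toReal_ofReal hq0.le]
  have hBf : ∫⁻ y, H y ^ p ≠ ∞ := by
    rw [hLp] at hB
    intro hcon
    rw [hcon, ENNReal.top_rpow_of_pos (by positivity)] at hB
    exact lt_irrefl _ hB
  have hTb := hb G H hGm hHm hA.ne hBf
  rw [hLp]
  have hF : ∀ k, LpE volume Q (fun t => (∫⁻ s, g (t - s) * h s) * ψ (t - k)) ≤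
      ∫⁻ w, (D * χ w) * T (k - w) := by
    intro k
    refine (hwin k).trans (le_of_eq ?_)
    have := lintegral_sub_left_eq_self (μ := (volume : Measure ℝ))
      (fun w => (D * χ w) * T (k - w)) k
    rw [← this]
    refine lintegral_congr fun x => ?_
    simp only [sub_sub_cancel]
    rfl
  calc _ ≤ LpE volume (ENNReal.ofReal q) (fun k => ∫⁻ w, (D * χ w) * T (k - w)) := LpE_mono hF
    _ = (∫⁻ k, (∫⁻ w, (D * χ w) * T (k - w)) ^ q) ^ (1 / q) := hLq _
    _ ≤ ∫⁻ w, (∫⁻ k, ((D * χ w) * T (k - w)) ^ q) ^ (1 / q) := by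
        refine minkowski_fin volume hpq (u := fun k w => (D * χ w) * T (k - w)) ?_
        simp only [Function.uncurry_def]
        fun_prop
    _ = ∫⁻ w, (D * χ w) * (∫⁻ x, T x ^ q) ^ (1 / q) := by
        refine lintegral_congr fun w => ?_
        have hDw : D * χ w ≠ ∞ := ENNReal.mul_ne_top hDt (hχt w)
        rw [← hLq, LpE_const_mul (by simpa using hq0) hDw, hLq,
          lintegral_sub_right_eq_self (fun x => T x ^ q) w]
    _ = D * (∫⁻ w, χ w) * (∫⁻ x, T x ^ q) ^ (1 / q) := by
        rw [lintegral_mul_const _ (by fun_prop), lintegral_const_mul _ hχm]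
    _ ≤ D * (∫⁻ w, χ w) * (K * wkLp (q / 2) G * (∫⁻ y, H y ^ p) ^ (1 / p)) := by gcongr
    _ = _ := by ring

lemma LpE_ae_lt_top {P : ℝ≥0∞} (hP : P ≠ 0) {f : ℝ → ℝ≥0∞} (hf : Measurable f)
    (h : LpE volume P f < ∞) : ∀ᵐ x, f x < ∞ := by
  unfold LpE at h
  split_ifs at h with hPt
  · filter_upwards [ENNReal.ae_le_essSup (μ := (volume : Measure ℝ)) f] with x hx
    exact hx.trans_lt h
  · have hp : 0 < P.toReal := ENNReal.toReal_pos hP hPt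
    have h1 : ∫⁻ x, f x ^ P.toReal ≠ ∞ := by
      intro hcon
      rw [hcon, ENNReal.top_rpow_of_pos (by positivity)] at h
      exact lt_irrefl _ h
    filter_upwards [ae_lt_top (hf.pow_const _) h1] with x hx
    by_contra hcon
    rw [not_lt, top_le_iff] at hcon
    rw [hcon, ENNReal.top_rpow_of_pos hp] at hx
    exact lt_irrefl _ hx

lemma ae_finite_of_amalgam {Q P : ℝ≥0∞} (hQ : Q ≠ 0) (hP : P ≠ 0) {F ψ : ℝ → ℝ≥0∞}
    (hF : Measurable F) (hψ : Measurable ψ) (hc0 : ∫⁻ x, ψ x ≠ 0)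
    (hlt : LpE volume P (fun k => LpE volume Q (fun t => F t * ψ (t - k))) < ∞) :
    ∀ᵐ t, F t < ∞ := by
  have hum : Measurable fun z : ℝ × ℝ => F z.1 * ψ (z.1 - z.2) := by fun_prop
  have hLm : Measurable fun k => LpE volume Q (fun t => F t * ψ (t - k)) :=
    measurable_LpE Q (u := fun t k => F t * ψ (t - k)) hum
  have h0 := LpE_ae_lt_top hP hLm hlt
  have h1 : ∀ᵐ k : ℝ, ∀ᵐ t : ℝ, F t * ψ (t - k) < ∞ := by
    filter_upwards [h0] with k hk
    have hm : Measurable fun t => F t * ψ (t - k) := by fun_prop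
    exact LpE_ae_lt_top hQ hm hk
  have hms : MeasurableSet {z : ℝ × ℝ | F z.2 * ψ (z.2 - z.1) < ∞} := by
    have : Measurable fun z : ℝ × ℝ => F z.2 * ψ (z.2 - z.1) := by fun_prop
    exact measurableSet_lt this measurable_const
  have h2 : ∀ᵐ t : ℝ, ∀ᵐ k : ℝ, F t * ψ (t - k) < ∞ :=
    (Measure.ae_ae_comm (p := fun k t => F t * ψ (t - k) < ∞) hms).1 h1
  filter_upwards [h2] with t ht
  by_contra hcon
  rw [not_lt, top_le_iff] at hcon
  apply hc0
  have hm : Measurable fun k => ψ (t - k) := by fun_prop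
  rw [← lintegral_sub_left_eq_self ψ t, lintegral_eq_zero_iff hm]
  filter_upwards [ht] with k hk
  by_contra hne
  rw [hcon, ENNReal.top_mul hne] at hk
  exact lt_irrefl _ hk

theorem amalgam_convolution (q' : ℝ≥0∞) (hq' : 2 ≤ q') (q : ℝ) (hq : 2 < q)
    (q'c : ℝ≥0∞) (hq'c : q'⁻¹ + q'c⁻¹ = 1) (qc : ℝ) (hqc : 1 / q + 1 / qc = 1)
    (φ : ℝ → ℝ) (hφ : ContDiff ℝ (⊤ : ℕ∞) φ) (hφc : HasCompactSupport φ) (hφne : φ ≠ 0) :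
    ∃ C : ℝ, 0 < C ∧ ∀ g h : ℝ → ℂ, Measurable g → Measurable h →
      wkLp (q / 2) (fun k =>
          LpE volume (q' / 2) (fun t => (‖g t * φ (t - k)‖₊ : ℝ≥0∞))) < ∞ →
      LpE volume (ENNReal.ofReal qc) (fun k =>
          LpE volume q'c (fun t => (‖h t * φ (t - k)‖₊ : ℝ≥0∞))) < ∞ →
      (∀ᵐ t : ℝ, Integrable (fun s => g (t - s) * h s)) ∧
      LpE volume (ENNReal.ofReal q) (fun k =>
          LpE volume q' (fun t => (‖(∫ s : ℝ, g (t - s) * h s) * φ (t - k)‖₊ : ℝ≥0∞)))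
        ≤ ENNReal.ofReal C *
            wkLp (q / 2) (fun k =>
              LpE volume (q' / 2) (fun t => (‖g t * φ (t - k)‖₊ : ℝ≥0∞))) *
            LpE volume (ENNReal.ofReal qc) (fun k =>
              LpE volume q'c (fun t => (‖h t * φ (t - k)‖₊ : ℝ≥0∞))) := by
  have hpq : qc.HolderConjugate q :=
    (Real.holderConjugate_iff.2 ⟨by linarith, by simpa only [one_div] using hqc⟩).symm
  have hcont : Continuous φ := hφ.continuous
  set ψ : ℝ → ℝ≥0∞ := fun x => ‖φ x‖ₑ with hψdef
  have hψ : Measurable ψ := hcont.measurable.enorm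
  obtain ⟨M, hM⟩ := hcont.bounded_above_of_compact_support hφc
  have hM' : ∀ x, ψ x ≤ ENNReal.ofReal M := by
    intro x
    simp only [hψdef]
    rw [← ofReal_norm]
    exact ENNReal.ofReal_le_ofReal (hM x)
  obtain ⟨R, hR⟩ := hφc.isCompact.isBounded.exists_norm_le
  have hR' : ∀ x, ψ x ≠ 0 → |x| ≤ R := by
    intro x hx
    refine hR x (subset_tsupport _ ?_)
    simpa [hψdef] using hx
  have hint : Integrable φ := hcont.integrable_of_hasCompactSupport hφc
  have hct : ∫⁻ x, ψ x ≠ ∞ := hint.2.ne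
  have hc0 : ∫⁻ x, ψ x ≠ 0 := by
    intro h0
    rw [lintegral_eq_zero_iff hψ] at h0
    apply hφne
    refine hcont.ae_eq_iff_eq (μ := volume) continuous_zero |>.1 ?_
    filter_upwards [h0] with x hx
    simpa [hψdef] using hx
  obtain ⟨C0, hC0, hmain⟩ := amalgam_ennreal hq' hq'c hpq hq hψ ENNReal.ofReal_ne_top hM' hR' hc0 hct
  have hQ0 : q' ≠ 0 := by rintro rfl; simp at hq'
  have hq0 : 0 < q := by linarith
  refine ⟨C0.toReal + 1, by positivity, ?_⟩
  intro g h hg hh hA hB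
  have hconv : ∀ (z : ℂ) (x : ℝ), ((‖z * (φ x : ℂ)‖₊ : ℝ≥0) : ℝ≥0∞) = ‖z‖ₑ * ψ x := by
    intro z x
    change ‖z * (φ x : ℂ)‖ₑ = _
    rw [enorm_mul]
    congr 1
    simp [hψdef, enorm_eq_nnnorm]
  simp only [hconv] at hA hB ⊢
  have hb := hmain (fun t => ‖g t‖ₑ) (fun t => ‖h t‖ₑ) hg.enorm hh.enorm hA hB
  set A := wkLp (q / 2) (fun k => LpE volume (q' / 2) (fun t => ‖g t‖ₑ * ψ (t - k)))
  set B := LpE volume (ENNReal.ofReal qc) (fun k => LpE volume q'c (fun t => ‖h t‖ₑ * ψ (t - k)))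
  have hLm : Measurable fun t => ∫⁻ s, ‖g (t - s)‖ₑ * ‖h s‖ₑ := by
    have : Measurable fun z : ℝ × ℝ => ‖g (z.1 - z.2)‖ₑ * ‖h z.2‖ₑ := by fun_prop
    exact this.lintegral_prod_right'
  constructor
  · have hlt := hb.trans_lt (ENNReal.mul_lt_top (ENNReal.mul_lt_top hC0.lt_top hA) hB)
    filter_upwards [ae_finite_of_amalgam hQ0 (by simpa using hq0) hLm hψ hc0 hlt] with t hfin
    refine ⟨?_, ?_⟩
    · have : Measurable fun s => g (t - s) * h s := by fun_prop
      exact this.aestronglyMeasurable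
    · rw [hasFiniteIntegral_iff_enorm]
      simpa only [enorm_mul] using hfin
  · calc _ ≤ LpE volume (ENNReal.ofReal q) (fun k => LpE volume q'
          (fun t => (∫⁻ s, ‖g (t - s)‖ₑ * ‖h s‖ₑ) * ψ (t - k))) := by
          refine LpE_mono fun k => LpE_mono fun t => ?_
          gcongr
          refine (enorm_integral_le_lintegral_enorm _).trans (le_of_eq ?_)
          simp only [enorm_mul]
      _ ≤ C0 * A * B := hb
      _ ≤ _ := by
          gcongr
          rw [← ENNReal.ofReal_toReal hC0]
          exact ENNReal.ofReal_le_ofReal (by simp)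


end
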